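/- arXiv:1505.00574 — 3 statements merged into one kernel-verified Lean document; each statement's English description precedes it below -/
import Mathlib

section
/- Let n ≥ 1, let X be a finite set of nodes in ℝ² with #X ≤ 2n + ⌊n/2⌋ + 1, and let A ∈ X. Suppose that: (a) no n+1 nodes of X \ {A} are collinear together with A; (b) whenever n+1 nodes of X \ {A} lie on a line α, no n nodes of X \ ({A} ∪ α) are collinear together with A; and (c) no 2n+1 nodes of X \ {A} lie together with A on an irreducible conic. Then A has an n-fundamental polynomial which is a product of polynomials each of total degree 1 or 2. -/
open MvPolynomial
open scoped Classical

noncomputable section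

/-- A point (node) in the plane `ℝ²`. -/
abbrev Pt : Type := Fin 2 → ℝ

/-- A bivariate real polynomial. -/
abbrev BivPoly : Type := MvPolynomial (Fin 2) ℝ

/-- `p` is an `n`-fundamental polynomial of the node `A` with respect to the node set `X`:
it has total degree at most `n`, equals `1` at `A` and vanishes at all other nodes of `X`. -/
def IsFundamental (n : ℕ) (X : Finset Pt) (A : Pt) (p : BivPoly) : Prop :=
  p.totalDegree ≤ n ∧ eval A p = 1 ∧ ∀ B ∈ X, B ≠ A → eval B p = 0

/-- `X` is `n`-independent: every node of `X` has an `n`-fundamental polynomial. -/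
def IsIndependent (n : ℕ) (X : Finset Pt) : Prop :=
  ∀ A ∈ X, ∃ p : BivPoly, IsFundamental n X A p

/-- `p` is a product of finitely many polynomials each of total degree `1` or `2`. -/
def IsProductOfLinesAndConics (p : BivPoly) : Prop :=
  ∃ L : Multiset BivPoly, (∀ q ∈ L, q.totalDegree = 1 ∨ q.totalDegree = 2) ∧ p = L.prod

/-- Condition (a): no `n+1` nodes of `X \ {A}` are collinear together with `A`. -/
def CondA (n : ℕ) (X : Finset Pt) (A : Pt) : Prop :=
  ¬ ∃ S ⊆ X.erase A, n + 1 ≤ S.card ∧ Collinear ℝ (insert A (S : Set Pt))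

/-- Condition (b): if `n+1` nodes of `X \ {A}` lie on an affine line `α`, then no `n`
nodes of `X \ ({A} ∪ α)` are collinear together with `A`. -/
def CondB (n : ℕ) (X : Finset Pt) (A : Pt) : Prop :=
  ∀ α : AffineSubspace ℝ Pt, Module.finrank ℝ α.direction = 1 →
    (∃ S ⊆ X.erase A, n + 1 ≤ S.card ∧ (S : Set Pt) ⊆ (α : Set Pt)) →
    ¬ ∃ T ⊆ X.erase A, n ≤ T.card ∧ (∀ B ∈ T, B ∉ α) ∧
      Collinear ℝ (insert A (T : Set Pt))

/-- Condition (c): no `2n+1` nodes of `X \ {A}` lie together with `A` on an irreducible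
conic, i.e. on the zero set of an irreducible polynomial of total degree `2`. -/
def CondC (n : ℕ) (X : Finset Pt) (A : Pt) : Prop :=
  ¬ ∃ q : BivPoly, Irreducible q ∧ q.totalDegree = 2 ∧ eval A q = 0 ∧
    2 * n + 1 ≤ ((X.erase A).filter (fun B => eval B q = 0)).card

section Transversal
variable {α ι : Type*} [DecidableEq α] [DecidableEq ι]

/-- If every subset of `Y` satisfies the Rado condition for the lists `a`, and the list of `y` has
two entries, then one of them can be erased while keeping the condition. -/
theorem exists_erase_of_rado [Fintype ι] (Y : Finset α) (ρ : ι → Finset α → ℕ)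
    (hmono : ∀ i, Monotone (ρ i))
    (hsub : ∀ i S T, ρ i (S ∪ T) + ρ i (S ∩ T) ≤ ρ i S + ρ i T)
    (a : α → Finset ι) (ha : ∀ T ⊆ Y, T.card ≤ ∑ i, ρ i (T.filter fun x => i ∈ a x))
    {y : α} {i j : ι} (hij : i ≠ j) :
    (∀ T ⊆ Y, T.card ≤ ∑ l, ρ l (T.filter fun x => l ∈ Function.update a y ((a y).erase i) x)) ∨
    (∀ T ⊆ Y, T.card ≤
      ∑ l, ρ l (T.filter fun x => l ∈ Function.update a y ((a y).erase j) x)) := by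
  by_contra! hcon
  obtain ⟨⟨T₁, hT₁, h₁⟩, T₂, hT₂, h₂⟩ := hcon
  have mem_of_fail : ∀ (T : Finset α) (m : ι), T ⊆ Y →
      ∑ l, ρ l (T.filter fun x => l ∈ Function.update a y ((a y).erase m) x) < T.card →
      y ∈ T := by
    intro T m hT hlt
    by_contra hy
    refine absurd (ha T hT) (not_le.2 (lt_of_le_of_lt (le_of_eq ?_) hlt))
    refine Finset.sum_congr rfl fun l _ => congrArg _ (Finset.filter_congr fun x hx => ?_)
    rw [Function.update_of_ne (by rintro rfl; exact hy hx)]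
  have hy₁ := mem_of_fail T₁ i hT₁ h₁
  have hy₂ := mem_of_fail T₂ j hT₂ h₂
  have hU := ha (T₁ ∪ T₂) (Finset.union_subset hT₁ hT₂)
  have hI := ha ((T₁ ∩ T₂).erase y)
    ((Finset.erase_subset _ _).trans (Finset.inter_subset_left.trans hT₁))
  have hcardI := Finset.card_erase_add_one (Finset.mem_inter.2 ⟨hy₁, hy₂⟩)
  have hcard := Finset.card_union_add_card_inter T₁ T₂
  have key : ∑ l, ρ l ((T₁ ∪ T₂).filter fun x => l ∈ a x) +
      ∑ l, ρ l (((T₁ ∩ T₂).erase y).filter fun x => l ∈ a x) ≤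
      ∑ l, ρ l (T₁.filter fun x => l ∈ Function.update a y ((a y).erase i) x) +
      ∑ l, ρ l (T₂.filter fun x => l ∈ Function.update a y ((a y).erase j) x) := by
    rw [← Finset.sum_add_distrib, ← Finset.sum_add_distrib]
    refine Finset.sum_le_sum fun l _ => (add_le_add (hmono l ?_) (hmono l ?_)).trans (hsub l _ _)
    · intro x hx
      simp only [Finset.mem_filter, Finset.mem_union] at hx ⊢
      by_cases hxy : x = y
      · subst hxy
        simp only [Function.update_self, Finset.mem_erase]
        by_cases hli : l = i
        · exact Or.inr ⟨hy₂, hli ▸ hij, hx.2⟩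
        · exact Or.inl ⟨hy₁, hli, hx.2⟩
      · simp only [Function.update_of_ne hxy]
        tauto
    · intro x hx
      simp only [Finset.mem_filter, Finset.mem_inter, Finset.mem_erase] at hx ⊢
      simp only [Function.update_of_ne hx.1.1]
      tauto
  omega

/-- If a family of polymatroid rank functions satisfies the Rado condition on `Y`, then the elements
of `Y` can be distributed among the members of the family so that each part is independent. -/
theorem exists_partition_of_card_le_sum_rank [Fintype ι] (Y : Finset α) (ρ : ι → Finset α → ℕ)
    (hmono : ∀ i, Monotone (ρ i)) (hempty : ∀ i, ρ i ∅ = 0)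
    (hsub : ∀ i S T, ρ i (S ∪ T) + ρ i (S ∩ T) ≤ ρ i S + ρ i T)
    (h : ∀ T ⊆ Y, T.card ≤ ∑ i, ρ i T) :
    ∃ S : ι → Finset α, (∀ y ∈ Y, ∃ i, y ∈ S i) ∧ ∀ i, (S i).card ≤ ρ i (S i) := by
  have hex : ∃ N, ∃ a : α → Finset ι, ∑ y ∈ Y, (a y).card = N ∧
      ∀ T ⊆ Y, T.card ≤ ∑ i, ρ i (T.filter fun x => i ∈ a x) :=
    ⟨_, fun _ => Finset.univ, rfl, by simpa using h⟩
  obtain ⟨a, haN, ha⟩ := Nat.find_spec hex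
  have hle : ∀ y ∈ Y, (a y).card ≤ 1 := by
    intro y hy
    by_contra! hlt
    obtain ⟨i, hi, j, hj, hij⟩ := Finset.one_lt_card.1 hlt
    have smaller : ∀ m ∈ a y, ¬ ∀ T ⊆ Y, T.card ≤
        ∑ l, ρ l (T.filter fun x => l ∈ Function.update a y ((a y).erase m) x) := by
      intro m hm hgood
      refine Nat.find_min hex ?_ ⟨_, rfl, hgood⟩
      rw [← haN]
      refine Finset.sum_lt_sum (fun x _ => ?_) ⟨y, hy, ?_⟩
      · by_cases hxy : x = y
        · subst hxy
          simpa using Finset.card_erase_le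
        · rw [Function.update_of_ne hxy]
      · simpa using Finset.card_erase_lt_of_mem hm
    rcases exists_erase_of_rado Y ρ hmono hsub a ha (y := y) hij with h' | h'
    · exact smaller i hi h'
    · exact smaller j hj h'
  refine ⟨fun i => Y.filter fun x => i ∈ a x, fun y hy => ?_, fun i => ?_⟩
  · by_contra! hno
    have hay : ∀ i, i ∉ a y := fun i hi => hno i (Finset.mem_filter.2 ⟨hy, hi⟩)
    have := ha {y} (Finset.singleton_subset_iff.2 hy)
    simp [Finset.filter_singleton, hay, hempty] at this
  · refine (ha _ (Finset.filter_subset _ _)).trans ?_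
    rw [Finset.sum_eq_single i]
    · simp [Finset.filter_filter]
    · intro j _ hji
      rw [Finset.filter_filter, Finset.filter_false_of_mem, hempty]
      rintro x hx ⟨h1, h2⟩
      exact hji (Finset.card_le_one.1 (hle x hx) j h2 i h1)
    · simp
end Transversal

section PointRank
variable {d : ℕ} {v : Pt → Fin d → ℝ}

/-- The rank of the vectors attached by `v` to the points of `S`. -/
def pointRank (v : Pt → Fin d → ℝ) (S : Finset Pt) : ℕ :=
  Module.finrank ℝ (Submodule.span ℝ (v '' (S : Set Pt)))

theorem pointRank_mono (v : Pt → Fin d → ℝ) : Monotone (pointRank v) := fun _ _ h =>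
  Submodule.finrank_mono (Submodule.span_mono (Set.image_mono (Finset.coe_subset.2 h)))

theorem pointRank_union_add_inter_le (v : Pt → Fin d → ℝ) (S T : Finset Pt) :
    pointRank v (S ∪ T) + pointRank v (S ∩ T) ≤ pointRank v S + pointRank v T := by
  unfold pointRank
  rw [← Submodule.finrank_sup_add_finrank_inf_eq (Submodule.span ℝ (v '' (S : Set Pt))),
    ← Submodule.span_union, ← Set.image_union, ← Finset.coe_union]
  refine Nat.add_le_add_left (Submodule.finrank_mono (le_inf ?_ ?_)) _ <;>
  refine Submodule.span_mono (Set.image_mono (Finset.coe_subset.2 ?_))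
  exacts [Finset.inter_subset_left, Finset.inter_subset_right]

theorem pointRank_le_card (v : Pt → Fin d → ℝ) (S : Finset Pt) : pointRank v S ≤ S.card := by
  unfold pointRank
  rw [← Finset.coe_image]
  exact (finrank_span_finset_le_card _).trans Finset.card_image_le

theorem exists_dotProduct_eq_of_dual (f : Module.Dual ℝ (Fin d → ℝ)) :
    ∃ c : Fin d → ℝ, ∀ w, c ⬝ᵥ w = f w := by
  refine ⟨fun i => f (Pi.single i 1), fun w => ?_⟩
  rw [LinearMap.pi_apply_eq_sum_univ f w]
  refine Finset.sum_congr rfl fun i _ => ?_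
  rw [smul_eq_mul, mul_comm]
  congr!
  simp [Pi.single_apply, eq_comm]

theorem exists_dotProduct_ne_zero_of_notMem {S : Finset Pt} {w : Fin d → ℝ}
    (hw : w ∉ Submodule.span ℝ (v '' (S : Set Pt))) :
    ∃ c : Fin d → ℝ, c ⬝ᵥ w ≠ 0 ∧ ∀ P ∈ S, c ⬝ᵥ v P = 0 := by
  obtain ⟨f, hf, hf'⟩ := Submodule.exists_dual_map_eq_bot_of_notMem hw inferInstance
  obtain ⟨c, hc⟩ := exists_dotProduct_eq_of_dual f
  refine ⟨c, by rwa [hc], fun P hP => ?_⟩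
  rw [hc, ← Submodule.mem_bot ℝ, ← hf']
  exact Submodule.mem_map_of_mem (Submodule.subset_span (Set.mem_image_of_mem _ hP))

theorem exists_dotProduct_eq_zero_of_pointRank_lt {S : Finset Pt} (h : pointRank v S < d) :
    ∃ c : Fin d → ℝ, c ≠ 0 ∧ ∀ P ∈ S, c ⬝ᵥ v P = 0 := by
  have hne : Submodule.span ℝ (v '' (S : Set Pt)) ≠ ⊤ := by
    intro htop
    rw [pointRank, htop, finrank_top, Module.finrank_fin_fun] at h
    exact lt_irrefl _ h
  obtain ⟨w, -, hw⟩ := SetLike.exists_of_lt hne.lt_top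
  obtain ⟨c, hc, hS⟩ := exists_dotProduct_ne_zero_of_notMem hw
  exact ⟨c, by rintro rfl; simp at hc, hS⟩

theorem pointRank_add_one_le_insert {S : Finset Pt} {P : Pt} {c : Fin d → ℝ}
    (hS : ∀ Q ∈ S, c ⬝ᵥ v Q = 0) (hP : c ⬝ᵥ v P ≠ 0) :
    pointRank v S + 1 ≤ pointRank v (insert P S) := by
  refine Submodule.finrank_lt_finrank_of_lt (SetLike.lt_iff_le_and_exists.2
    ⟨Submodule.span_mono (Set.image_mono (Finset.coe_subset.2 (Finset.subset_insert _ _))),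
      v P, Submodule.subset_span ⟨P, by simp, rfl⟩, fun hmem => hP ?_⟩)
  generalize v P = w at hmem
  induction hmem using Submodule.span_induction with
  | mem x hx =>
    obtain ⟨Q, hQ, rfl⟩ := hx
    exact hS Q hQ
  | zero => simp
  | add x y _ _ hx hy => rw [dotProduct_add, hx, hy, add_zero]
  | smul a x _ hx => rw [dotProduct_smul, hx, smul_zero]

theorem exists_dotProduct_separating {S : Finset Pt} {A : Pt}
    (h : S.card + 1 ≤ pointRank v (insert A S)) :
    ∃ c : Fin d → ℝ, c ⬝ᵥ v A ≠ 0 ∧ ∀ P ∈ S, c ⬝ᵥ v P = 0 := by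
  refine exists_dotProduct_ne_zero_of_notMem fun hmem => ?_
  have heq : pointRank v (insert A S) = pointRank v S := by
    rw [pointRank, Finset.coe_insert, Set.image_insert_eq, Submodule.span_insert_eq_span hmem,
      pointRank]
  have := pointRank_le_card v S
  omega

end PointRank

/-- The monomials of degree at most `1` evaluated at `P`. -/
def linearMonomials (P : Pt) : Fin 3 → ℝ := ![1, P 0, P 1]

/-- The monomials of degree at most `2` evaluated at `P`. -/
def quadraticMonomials (P : Pt) : Fin 6 → ℝ := ![1, P 0, P 1, P 0 ^ 2, P 0 * P 1, P 1 ^ 2]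

theorem dotProduct_linearMonomials (c : Fin 3 → ℝ) (P : Pt) :
    c ⬝ᵥ linearMonomials P = c 0 + c 1 * P 0 + c 2 * P 1 := by
  simp [linearMonomials, dotProduct, Fin.sum_univ_succ]
  ring

theorem dotProduct_quadraticMonomials (c : Fin 6 → ℝ) (P : Pt) :
    c ⬝ᵥ quadraticMonomials P = c 0 + c 1 * P 0 + c 2 * P 1 + c 3 * P 0 ^ 2 +
      c 4 * (P 0 * P 1) + c 5 * P 1 ^ 2 := by
  simp [quadraticMonomials, dotProduct, Fin.sum_univ_succ]
  ring_nf

/-- The polynomial of degree at most `2` with coefficient vector `c`. -/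
def quadraticPoly (c : Fin 6 → ℝ) : BivPoly :=
  C (c 0) + C (c 1) * X 0 + C (c 2) * X 1 + C (c 3) * X 0 ^ 2 + C (c 4) * (X 0 * X 1) +
    C (c 5) * X 1 ^ 2

/-- The polynomial of degree at most `1` with coefficient vector `c`. -/
def linearPoly (c : Fin 3 → ℝ) : BivPoly :=
  C (c 0) + C (c 1) * X 0 + C (c 2) * X 1

theorem eval_quadraticPoly (c : Fin 6 → ℝ) (P : Pt) :
    eval P (quadraticPoly c) = c ⬝ᵥ quadraticMonomials P := by
  simp [quadraticPoly, dotProduct_quadraticMonomials]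

theorem eval_linearPoly (c : Fin 3 → ℝ) (P : Pt) :
    eval P (linearPoly c) = c ⬝ᵥ linearMonomials P := by
  simp [linearPoly, dotProduct_linearMonomials]

theorem totalDegree_C_mul_le (a : ℝ) (p : BivPoly) : (C a * p).totalDegree ≤ p.totalDegree := by
  simpa using totalDegree_mul (C a) p

theorem totalDegree_add_le_of_le {p q : BivPoly} {m : ℕ} (hp : p.totalDegree ≤ m)
    (hq : q.totalDegree ≤ m) : (p + q).totalDegree ≤ m :=
  (totalDegree_add p q).trans (max_le hp hq)

theorem totalDegree_linearPoly_le (c : Fin 3 → ℝ) : (linearPoly c).totalDegree ≤ 1 := by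
  refine totalDegree_add_le_of_le (totalDegree_add_le_of_le (by simp) ?_) ?_ <;>
  exact (totalDegree_C_mul_le _ _).trans (totalDegree_X _).le

theorem totalDegree_quadraticPoly_le (c : Fin 6 → ℝ) : (quadraticPoly c).totalDegree ≤ 2 := by
  refine totalDegree_add_le_of_le (totalDegree_add_le_of_le (totalDegree_add_le_of_le
    ((totalDegree_linearPoly_le ![c 0, c 1, c 2]).trans one_le_two) ?_) ?_) ?_ <;>
  refine (totalDegree_C_mul_le _ _).trans ?_
  · exact (totalDegree_X_pow _ _).le
  · exact (totalDegree_mul _ _).trans (by simp)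
  · exact (totalDegree_X_pow _ _).le

theorem quadraticPoly_ne_zero {c : Fin 6 → ℝ} (hc : c ≠ 0) : quadraticPoly c ≠ 0 := by
  intro h
  apply hc
  have key : ∀ x y : ℝ,
      c 0 + c 1 * x + c 2 * y + c 3 * x ^ 2 + c 4 * (x * y) + c 5 * y ^ 2 = 0 := by
    intro x y
    have := eval_quadraticPoly c ![x, y]
    rw [h, dotProduct_quadraticMonomials] at this
    simpa using this.symm
  have h0 := key 0 0
  have h1 := key 1 0
  have h2 := key (-1) 0
  have h3 := key 0 1
  have h4 := key 0 (-1)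
  have h5 := key 1 1
  funext i
  fin_cases i <;> simp <;> linarith

theorem exists_linearPoly_eq {f : BivPoly} (hf : f.totalDegree ≤ 1) :
    ∃ c : Fin 3 → ℝ, f = linearPoly c := by
  refine ⟨![coeff 0 f, coeff (Finsupp.single 0 1) f, coeff (Finsupp.single 1 1) f], ?_⟩
  ext m
  have hm : m = Finsupp.single 0 (m 0) + Finsupp.single 1 (m 1) := by
    ext i
    fin_cases i <;> simp
  generalize m 0 = a at hm
  generalize m 1 = b at hm
  subst hm
  have h0 : ∀ a b : ℕ, (0 : Fin 2 →₀ ℕ) = Finsupp.single 0 a + Finsupp.single 1 b ↔ a = 0 ∧ b = 0 := by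
    intro a b
    simp [Finsupp.ext_iff, eq_comm]
  have h1 : ∀ a b : ℕ, (Finsupp.single 0 1 : Fin 2 →₀ ℕ) =
      Finsupp.single 0 a + Finsupp.single 1 b ↔ a = 1 ∧ b = 0 := by
    intro a b
    simp [Finsupp.ext_iff, eq_comm]
  have h2 : ∀ a b : ℕ, (Finsupp.single 1 1 : Fin 2 →₀ ℕ) =
      Finsupp.single 0 a + Finsupp.single 1 b ↔ a = 0 ∧ b = 1 := by
    intro a b
    simp [Finsupp.ext_iff, eq_comm]
  simp only [linearPoly, coeff_add, coeff_C, coeff_C_mul, coeff_X, h0, h1, h2]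
  by_cases hab : a + b ≤ 1
  · obtain ⟨rfl, rfl⟩ | ⟨rfl, rfl⟩ | ⟨rfl, rfl⟩ :
      (a = 0 ∧ b = 0) ∨ (a = 1 ∧ b = 0) ∨ (a = 0 ∧ b = 1) := by omega
    all_goals simp
  · rw [coeff_eq_zero_of_totalDegree_lt, if_neg, if_neg, if_neg]
    · simp
    · omega
    · omega
    · omega
    · change _ < Finsupp.degree _
      rw [map_add, Finsupp.degree_single, Finsupp.degree_single]
      omega

/-- The coefficient vector of the product of two polynomials of degree at most `1`. -/
def mulLinear (f g : Fin 3 → ℝ) : Fin 6 → ℝ :=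
  ![f 0 * g 0, f 0 * g 1 + f 1 * g 0, f 0 * g 2 + f 2 * g 0, f 1 * g 1, f 1 * g 2 + f 2 * g 1,
    f 2 * g 2]

theorem mulLinear_dotProduct (f g : Fin 3 → ℝ) (P : Pt) :
    mulLinear f g ⬝ᵥ quadraticMonomials P =
      (f ⬝ᵥ linearMonomials P) * (g ⬝ᵥ linearMonomials P) := by
  rw [dotProduct_quadraticMonomials, dotProduct_linearMonomials, dotProduct_linearMonomials]
  simp only [mulLinear, Matrix.cons_val]
  ring

theorem exists_line_mem_notMem {P Q : Pt} (h : P ≠ Q) :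
    ∃ f : Fin 3 → ℝ, f ⬝ᵥ linearMonomials P = 0 ∧ f ⬝ᵥ linearMonomials Q ≠ 0 := by
  refine ⟨![-((Q 0 - P 0) * P 0 + (Q 1 - P 1) * P 1), Q 0 - P 0, Q 1 - P 1], ?_, fun h0 => h ?_⟩
  · rw [dotProduct_linearMonomials]
    simp only [Matrix.cons_val]
    ring
  · rw [dotProduct_linearMonomials] at h0
    simp only [Matrix.cons_val] at h0
    have hx : Q 0 - P 0 = 0 := by nlinarith [sq_nonneg (Q 0 - P 0), sq_nonneg (Q 1 - P 1)]
    have hy : Q 1 - P 1 = 0 := by nlinarith [sq_nonneg (Q 0 - P 0), sq_nonneg (Q 1 - P 1)]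
    funext i
    fin_cases i
    · exact (sub_eq_zero.1 hx).symm
    · exact (sub_eq_zero.1 hy).symm

theorem exists_line_through {P Q : Pt} (h : P ≠ Q) :
    ∃ f : Fin 3 → ℝ, f ≠ 0 ∧ f ⬝ᵥ linearMonomials P = 0 ∧ f ⬝ᵥ linearMonomials Q = 0 := by
  refine ⟨![(Q 0 - P 0) * P 1 - (Q 1 - P 1) * P 0, Q 1 - P 1, P 0 - Q 0], fun h0 => h ?_, ?_, ?_⟩
  · funext i
    fin_cases i
    · exact sub_eq_zero.1 (by simpa using congrFun h0 2)
    · exact (sub_eq_zero.1 (by simpa using congrFun h0 1)).symm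
  all_goals
    rw [dotProduct_linearMonomials]
    simp only [Matrix.cons_val]
    ring

theorem one_dotProduct_linearMonomials_ne_zero (P : Pt) :
    ![1, 0, 0] ⬝ᵥ linearMonomials P ≠ 0 := by
  rw [dotProduct_linearMonomials]
  simp

theorem pointRank_quadratic_insert {S : Finset Pt} {P : Pt} (f g : Fin 3 → ℝ)
    (hS : ∀ Q ∈ S, f ⬝ᵥ linearMonomials Q = 0 ∨ g ⬝ᵥ linearMonomials Q = 0)
    (hf : f ⬝ᵥ linearMonomials P ≠ 0) (hg : g ⬝ᵥ linearMonomials P ≠ 0) :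
    pointRank quadraticMonomials S + 1 ≤ pointRank quadraticMonomials (insert P S) := by
  refine pointRank_add_one_le_insert (c := mulLinear f g) (fun Q hQ => ?_) ?_
  · rw [mulLinear_dotProduct]
    exact mul_eq_zero.2 (hS Q hQ)
  · rw [mulLinear_dotProduct]
    exact mul_ne_zero hf hg

theorem pointRank_linear_singleton (P : Pt) : 1 ≤ pointRank linearMonomials {P} :=
  (Nat.le_add_left _ _).trans (pointRank_add_one_le_insert (S := ∅) (c := ![1, 0, 0]) (by simp)
    (one_dotProduct_linearMonomials_ne_zero P))

theorem pointRank_quadratic_singleton (P : Pt) : 1 ≤ pointRank quadraticMonomials {P} :=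
  (Nat.le_add_left _ _).trans (pointRank_quadratic_insert (S := ∅) ![1, 0, 0] ![1, 0, 0] (by simp)
    (one_dotProduct_linearMonomials_ne_zero P) (one_dotProduct_linearMonomials_ne_zero P))

theorem two_le_pointRank_linear {Z : Finset Pt} (hZ : 2 ≤ Z.card) :
    2 ≤ pointRank linearMonomials Z := by
  obtain ⟨P, hP, Q, hQ, hPQ⟩ := Finset.one_lt_card.1 hZ
  obtain ⟨f, hfP, hfQ⟩ := exists_line_mem_notMem hPQ
  have h1 := pointRank_linear_singleton P
  have h2 := pointRank_add_one_le_insert (v := linearMonomials) (S := {P}) (by simpa using hfP) hfQ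
  have h3 := pointRank_mono linearMonomials (show insert Q {P} ⊆ Z by
    simp [Finset.insert_subset_iff, *])
  omega

theorem two_le_pointRank_pair {P Q : Pt} (hPQ : P ≠ Q) :
    2 ≤ pointRank quadraticMonomials {Q, P} := by
  obtain ⟨f, hfP, hfQ⟩ := exists_line_mem_notMem hPQ
  have h1 := pointRank_quadratic_singleton P
  have h2 := pointRank_quadratic_insert (S := {P}) f f (by simpa using hfP) hfQ hfQ
  omega

theorem three_le_pointRank_triple {P Q R : Pt} (hPQ : P ≠ Q) (hPR : P ≠ R) (hQR : Q ≠ R) :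
    3 ≤ pointRank quadraticMonomials {R, Q, P} := by
  obtain ⟨f, hfP, hfR⟩ := exists_line_mem_notMem hPR
  obtain ⟨g, hgQ, hgR⟩ := exists_line_mem_notMem hQR
  have h1 := two_le_pointRank_pair hPQ
  have h2 := pointRank_quadratic_insert (S := {Q, P}) f g (by simp [*]) hfR hgR
  omega

theorem two_le_pointRank_quadratic {Z : Finset Pt} (hZ : 2 ≤ Z.card) :
    2 ≤ pointRank quadraticMonomials Z := by
  obtain ⟨P, hP, Q, hQ, hPQ⟩ := Finset.one_lt_card.1 hZ
  exact (two_le_pointRank_pair hPQ).trans (pointRank_mono _ (by simp [Finset.insert_subset_iff, *]))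

theorem three_le_pointRank_quadratic {Z : Finset Pt} (hZ : 3 ≤ Z.card) :
    3 ≤ pointRank quadraticMonomials Z := by
  obtain ⟨P, hP, Q, hQ, R, hR, hPQ, hPR, hQR⟩ := Finset.two_lt_card.1 hZ
  exact (three_le_pointRank_triple hPQ hPR hQR).trans
    (pointRank_mono _ (by simp [Finset.insert_subset_iff, *]))

theorem add_le_pointRank_of_line {Z : Finset Pt} {f : Fin 3 → ℝ} {r : ℕ} (hr : r ≤ 2)
    (hon : 3 ≤ (Z.filter fun P => f ⬝ᵥ linearMonomials P = 0).card)
    (hoff : r ≤ (Z.filter fun P => f ⬝ᵥ linearMonomials P ≠ 0).card) :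
    3 + r ≤ pointRank quadraticMonomials Z := by
  have h3 := three_le_pointRank_quadratic hon
  have hsub := Finset.filter_subset (fun P => f ⬝ᵥ linearMonomials P = 0) Z
  obtain rfl | rfl | rfl : r = 0 ∨ r = 1 ∨ r = 2 := by omega
  · exact h3.trans (pointRank_mono _ hsub)
  · obtain ⟨Q, hQ⟩ := Finset.card_pos.1 hoff
    obtain ⟨hQZ, hfQ⟩ := Finset.mem_filter.1 hQ
    have h4 := pointRank_quadratic_insert
      (S := Z.filter fun P => f ⬝ᵥ linearMonomials P = 0) f ![1, 0, 0]
      (fun R hR => Or.inl (Finset.mem_filter.1 hR).2) hfQ (one_dotProduct_linearMonomials_ne_zero Q)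
    have := pointRank_mono quadraticMonomials
      (Finset.insert_subset hQZ hsub)
    omega
  · obtain ⟨Q, hQ, R, hR, hQR⟩ := Finset.one_lt_card.1 hoff
    obtain ⟨hQZ, hfQ⟩ := Finset.mem_filter.1 hQ
    obtain ⟨hRZ, hfR⟩ := Finset.mem_filter.1 hR
    have h4 := pointRank_quadratic_insert
      (S := Z.filter fun P => f ⬝ᵥ linearMonomials P = 0) f ![1, 0, 0]
      (fun R hR => Or.inl (Finset.mem_filter.1 hR).2) hfQ (one_dotProduct_linearMonomials_ne_zero Q)
    obtain ⟨g, hgQ, hgR⟩ := exists_line_mem_notMem hQR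
    have h5 := pointRank_quadratic_insert
      (S := insert Q (Z.filter fun P => f ⬝ᵥ linearMonomials P = 0)) f g (fun S hS => by
      rcases Finset.mem_insert.1 hS with rfl | hS
      · exact Or.inr hgQ
      · exact Or.inl (Finset.mem_filter.1 hS).2) hfR hgR
    have := pointRank_mono quadraticMonomials
      (Finset.insert_subset hRZ (Finset.insert_subset hQZ hsub))
    omega

theorem min_card_le_pointRank_of_no_three_collinear {Z : Finset Pt} (h4 : 4 ≤ Z.card)
    (hgen : ∀ f : Fin 3 → ℝ, f ≠ 0 → (Z.filter fun P => f ⬝ᵥ linearMonomials P = 0).card ≤ 2) :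
    min Z.card 5 ≤ pointRank quadraticMonomials Z := by
  have hoff : ∀ {P Q R : Pt} {f : Fin 3 → ℝ}, P ∈ Z → Q ∈ Z → R ∈ Z → P ≠ Q → P ≠ R → Q ≠ R →
      f ≠ 0 → f ⬝ᵥ linearMonomials P = 0 → f ⬝ᵥ linearMonomials Q = 0 →
      f ⬝ᵥ linearMonomials R ≠ 0 := by
    intro P Q R f hP hQ hR hPQ hPR hQR hf hfP hfQ hfR
    refine absurd (hgen f hf) (not_le.2 (Finset.two_lt_card.2
      ⟨P, ?_, Q, ?_, R, ?_, hPQ, hPR, hQR⟩))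
    all_goals exact Finset.mem_filter.2 ⟨by assumption, by assumption⟩
  obtain ⟨P, hP, Q, hQ, R, hR, hPQ, hPR, hQR⟩ :=
    Finset.two_lt_card.1 (show 2 < Z.card by omega)
  obtain ⟨S, hS, hSn⟩ := Finset.exists_mem_notMem_of_card_lt_card
    (show ({R, Q, P} : Finset Pt).card < Z.card from Finset.card_le_three.trans_lt h4)
  simp only [Finset.mem_insert, Finset.mem_singleton, not_or] at hSn
  obtain ⟨hSR, hSQ, hSP⟩ := hSn
  obtain ⟨f, hf, hfP, hfQ⟩ := exists_line_through hPQ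
  obtain ⟨g, hgR, hgS⟩ := exists_line_mem_notMem (Ne.symm hSR)
  have r3 := three_le_pointRank_triple hPQ hPR hQR
  have r4 := pointRank_quadratic_insert (S := {R, Q, P}) f g (by simp [*])
    (hoff hP hQ hS hPQ (Ne.symm hSP) (Ne.symm hSQ) hf hfP hfQ) hgS
  have hsub4 : ({S, R, Q, P} : Finset Pt) ⊆ Z := by simp [Finset.insert_subset_iff, *]
  by_cases h5 : 5 ≤ Z.card
  · obtain ⟨T, hT, hTn⟩ := Finset.exists_mem_notMem_of_card_lt_card
      (show ({S, R, Q, P} : Finset Pt).card < Z.card from Finset.card_le_four.trans_lt h5)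
    simp only [Finset.mem_insert, Finset.mem_singleton, not_or] at hTn
    obtain ⟨hTS, hTR, hTQ, hTP⟩ := hTn
    obtain ⟨g, hg, hgR, hgS⟩ := exists_line_through (Ne.symm hSR)
    have r5 := pointRank_quadratic_insert (S := {S, R, Q, P}) f g (by simp [*])
      (hoff hP hQ hT hPQ (Ne.symm hTP) (Ne.symm hTQ) hf hfP hfQ)
      (hoff hR hS hT (Ne.symm hSR) (Ne.symm hTR) (Ne.symm hTS) hg hgR hgS)
    have := pointRank_mono quadraticMonomials (Finset.insert_subset hT hsub4)
    omega
  · have := pointRank_mono quadraticMonomials hsub4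
    omega

/-- There is a product of lines and conics of degree at most `m` that equals `1` at `A` and
vanishes on `S`. -/
def Covered (A : Pt) (m : ℕ) (S : Finset Pt) : Prop :=
  ∃ p : BivPoly, p.totalDegree ≤ m ∧ eval A p = 1 ∧ (∀ B ∈ S, eval B p = 0) ∧
    IsProductOfLinesAndConics p

theorem Covered.mono {A : Pt} {m m' : ℕ} {S S' : Finset Pt} (h : Covered A m S) (hm : m ≤ m')
    (hS : S' ⊆ S) : Covered A m' S' := by
  obtain ⟨p, h1, h2, h3, h4⟩ := h
  exact ⟨p, h1.trans hm, h2, fun B hB => h3 B (hS hB), h4⟩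

theorem Covered.empty (A : Pt) (m : ℕ) : Covered A m ∅ :=
  ⟨1, by simp, by simp, by simp, 0, by simp, by simp⟩

theorem Covered.union {A : Pt} {m m' : ℕ} {S S' : Finset Pt} (h : Covered A m S)
    (h' : Covered A m' S') : Covered A (m + m') (S ∪ S') := by
  obtain ⟨p, h1, h2, h3, L, hL, rfl⟩ := h
  obtain ⟨p', h1', h2', h3', L', hL', rfl⟩ := h'
  refine ⟨L.prod * L'.prod, (totalDegree_mul _ _).trans (add_le_add h1 h1'), by simp [h2, h2'],
    fun B hB => ?_, L + L', fun q hq => ?_, by simp⟩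
  · rcases Finset.mem_union.1 hB with hB | hB
    · simp [h3 B hB]
    · simp [h3' B hB]
  · exact (Multiset.mem_add.1 hq).elim (hL q) (hL' q)

theorem Covered.biUnion {ι : Type*} {A : Pt} (s : Finset ι) (m : ι → ℕ) (S : ι → Finset Pt)
    (h : ∀ i ∈ s, Covered A (m i) (S i)) : Covered A (∑ i ∈ s, m i) (s.biUnion S) := by
  induction s using Finset.induction_on with
  | empty => exact Covered.empty _ _
  | insert i s hi ih =>
    rw [Finset.sum_insert hi, Finset.biUnion_insert]
    exact (h i (Finset.mem_insert_self _ _)).union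
      (ih fun j hj => h j (Finset.mem_insert_of_mem hj))

theorem covered_of_poly {A : Pt} {m : ℕ} {S : Finset Pt} (hm : m ≤ 2) (q : BivPoly)
    (hq : q.totalDegree ≤ m) (hA : eval A q ≠ 0) (hS : ∀ B ∈ S, eval B q = 0) :
    Covered A m S := by
  set p : BivPoly := C (eval A q)⁻¹ * q with hp
  have hpd : p.totalDegree ≤ m := (totalDegree_C_mul_le _ _).trans hq
  have hpA : eval A p = 1 := by simp [hp, hA]
  have hpS : ∀ B ∈ S, eval B p = 0 := fun B hB => by simp [hp, hS B hB]
  by_cases h0 : p.totalDegree = 0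
  · rw [totalDegree_eq_zero_iff_eq_C] at h0
    have : S = ∅ := Finset.eq_empty_of_forall_notMem fun B hB => by
      have h1 := hpS B hB
      rw [h0, eval_C] at hpA h1
      exact one_ne_zero (hpA.symm.trans h1)
    exact this ▸ Covered.empty A m
  · refine ⟨p, hpd, hpA, hpS, {p}, ?_, by simp⟩
    simp only [Multiset.mem_singleton, forall_eq]
    omega

theorem covered_of_card_le_rank {A : Pt} {R : Finset Pt} {k l : ℕ}
    (h : ∀ T ⊆ R, T.card ≤ k * (pointRank quadraticMonomials (insert A T) - 1) +
      l * (pointRank linearMonomials (insert A T) - 1)) :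
    Covered A (2 * k + l) R := by
  have hpos₁ (T : Finset Pt) : 1 ≤ pointRank linearMonomials (insert A T) :=
    (pointRank_linear_singleton A).trans (pointRank_mono _ (by simp))
  have hpos₂ (T : Finset Pt) : 1 ≤ pointRank quadraticMonomials (insert A T) :=
    (pointRank_quadratic_singleton A).trans (pointRank_mono _ (by simp))
  let ρ : Fin k ⊕ Fin l → Finset Pt → ℕ :=
    Sum.elim (fun _ T => pointRank quadraticMonomials (insert A T) - 1)
      (fun _ T => pointRank linearMonomials (insert A T) - 1)
  obtain ⟨S, hcover, hS⟩ := exists_partition_of_card_le_sum_rank R ρ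
    (by
      rintro (i | i) S T hST <;>
      exact Nat.sub_le_sub_right (pointRank_mono _ (Finset.insert_subset_insert A hST)) 1)
    (by
      rintro (i | i)
      · have := pointRank_le_card quadraticMonomials {A}
        simp only [Finset.card_singleton] at this
        simp [ρ, this]
      · have := pointRank_le_card linearMonomials {A}
        simp only [Finset.card_singleton] at this
        simp [ρ, this])
    (by
      rintro (i | i) S T
      · have := pointRank_union_add_inter_le quadraticMonomials (insert A S) (insert A T)
        rw [← Finset.insert_union_distrib, ← Finset.insert_inter_distrib] at this
        have := hpos₂ (S ∪ T)
        have := hpos₂ (S ∩ T)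
        simp only [ρ, Sum.elim_inl]
        omega
      · have := pointRank_union_add_inter_le linearMonomials (insert A S) (insert A T)
        rw [← Finset.insert_union_distrib, ← Finset.insert_inter_distrib] at this
        have := hpos₁ (S ∪ T)
        have := hpos₁ (S ∩ T)
        simp only [ρ, Sum.elim_inr]
        omega)
    (fun T hT => (h T hT).trans (le_of_eq (by simp [ρ])))
  refine (Covered.biUnion Finset.univ (Sum.elim (fun _ => 2) (fun _ => 1)) S ?_).mono
    (by simp [mul_comm]) (fun y hy => by simpa using hcover y hy)
  rintro (i | i) -
  · have := hS (Sum.inl i)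
    simp only [ρ, Sum.elim_inl] at this
    have := hpos₂ (S (Sum.inl i))
    obtain ⟨c, hcA, hcS⟩ := exists_dotProduct_separating (v := quadraticMonomials)
      (S := S (Sum.inl i)) (A := A) (by omega)
    exact covered_of_poly le_rfl (quadraticPoly c) (totalDegree_quadraticPoly_le c)
      (by rwa [eval_quadraticPoly]) (fun B hB => by rw [eval_quadraticPoly, hcS B hB])
  · have := hS (Sum.inr i)
    simp only [ρ, Sum.elim_inr] at this
    have := hpos₁ (S (Sum.inr i))
    obtain ⟨c, hcA, hcS⟩ := exists_dotProduct_separating (v := linearMonomials)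
      (S := S (Sum.inr i)) (A := A) (by omega)
    exact covered_of_poly one_le_two (linearPoly c) (totalDegree_linearPoly_le c)
      (by rwa [eval_linearPoly]) (fun B hB => by rw [eval_linearPoly, hcS B hB])

theorem line_mem_iff {f : Fin 3 → ℝ} (hf : f ≠ 0) {P : Pt} (hP : f ⬝ᵥ linearMonomials P = 0)
    (B : Pt) : f ⬝ᵥ linearMonomials B = 0 ↔ ∃ r : ℝ, r • ![-f 2, f 1] = B - P := by
  rw [dotProduct_linearMonomials] at hP ⊢
  have hpos : f 1 ^ 2 + f 2 ^ 2 ≠ 0 := by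
    intro h0
    have h1 : f 1 = 0 := by nlinarith [sq_nonneg (f 1), sq_nonneg (f 2)]
    have h2 : f 2 = 0 := by nlinarith [sq_nonneg (f 1), sq_nonneg (f 2)]
    apply hf
    funext i
    fin_cases i
    · simpa [h1, h2] using hP
    · exact h1
    · exact h2
  constructor
  · intro hB
    refine ⟨(-f 2 * (B 0 - P 0) + f 1 * (B 1 - P 1)) / (f 1 ^ 2 + f 2 ^ 2), ?_⟩
    funext i
    fin_cases i
    · simp only [Fin.zero_eta, Pi.smul_apply, smul_eq_mul, Matrix.cons_val, Pi.sub_apply]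
      field_simp
      linear_combination (-f 1) * (hB - hP)
    · simp only [Fin.mk_one, Pi.smul_apply, smul_eq_mul, Matrix.cons_val, Pi.sub_apply]
      field_simp
      linear_combination (-f 2) * (hB - hP)
  · rintro ⟨r, hr⟩
    have h0 := congrFun hr 0
    have h1 := congrFun hr 1
    simp only [Pi.smul_apply, smul_eq_mul, Matrix.cons_val, Pi.sub_apply] at h0 h1
    linear_combination hP - f 1 * h0 - f 2 * h1

theorem collinear_insert_of_line {f : Fin 3 → ℝ} (hf : f ≠ 0) {A : Pt}
    (hA : f ⬝ᵥ linearMonomials A = 0) {S : Finset Pt}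
    (hS : ∀ B ∈ S, f ⬝ᵥ linearMonomials B = 0) : Collinear ℝ (insert A (S : Set Pt)) := by
  rw [collinear_iff_of_mem (Set.mem_insert A _)]
  refine ⟨![-f 2, f 1], fun B hB => ?_⟩
  have hB0 : f ⬝ᵥ linearMonomials B = 0 := by
    rcases hB with rfl | hB
    exacts [hA, hS B hB]
  obtain ⟨r, hr⟩ := (line_mem_iff hf hA B).1 hB0
  exact ⟨r, by rw [hr]; simp⟩

theorem exists_affineSubspace_of_line {f : Fin 3 → ℝ} (hf : f ≠ 0) {P : Pt}
    (hP : f ⬝ᵥ linearMonomials P = 0) :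
    ∃ α : AffineSubspace ℝ Pt, Module.finrank ℝ α.direction = 1 ∧
      ∀ B, B ∈ α ↔ f ⬝ᵥ linearMonomials B = 0 := by
  refine ⟨AffineSubspace.mk' P (Submodule.span ℝ {![-f 2, f 1]}), ?_, fun B => ?_⟩
  · rw [AffineSubspace.direction_mk']
    refine finrank_span_singleton fun h0 => hf ?_
    have h2 : f 2 = 0 := by simpa using congrFun h0 0
    have h1 : f 1 = 0 := by simpa using congrFun h0 1
    rw [dotProduct_linearMonomials] at hP
    funext i
    fin_cases i
    · simpa [h1, h2] using hP
    · exact h1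
    · exact h2
  · rw [AffineSubspace.mem_mk', Submodule.mem_span_singleton, line_mem_iff hf hP, vsub_eq_sub]

theorem linearPoly_zero : linearPoly 0 = 0 := by simp [linearPoly]

/-- A conic that is not irreducible contains at most twice as many points of `Y` as a line does. -/
theorem card_filter_conic_le {Y : Finset Pt} {n : ℕ}
    (hline : ∀ f : Fin 3 → ℝ, f ≠ 0 → (Y.filter fun P => f ⬝ᵥ linearMonomials P = 0).card ≤ n)
    {q : BivPoly} (hq0 : q ≠ 0) (hq2 : q.totalDegree ≤ 2)
    (hq : ¬ (Irreducible q ∧ q.totalDegree = 2)) :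
    (Y.filter fun P => eval P q = 0).card ≤ 2 * n := by
  have hline' : ∀ p : BivPoly, p ≠ 0 → p.totalDegree ≤ 1 →
      (Y.filter fun P => eval P p = 0).card ≤ n := by
    intro p hp hp1
    obtain ⟨c, rfl⟩ := exists_linearPoly_eq hp1
    simp only [eval_linearPoly]
    exact hline c (by rintro rfl; exact hp linearPoly_zero)
  by_cases h1 : q.totalDegree ≤ 1
  · have := hline' q hq0 h1
    omega
  have hdeg : q.totalDegree = 2 := by omega
  have unit_of_degree : ∀ p : BivPoly, p ≠ 0 → p.totalDegree = 0 → IsUnit p := by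
    intro p hp hp0
    rw [totalDegree_eq_zero_iff_eq_C] at hp0
    rw [hp0]
    refine (IsUnit.mk0 _ fun h => hp ?_).map C
    rw [hp0, h, C_0]
  have hnotunit : ¬ IsUnit q := fun hu => by
    have := (isUnit_iff_totalDegree_of_isReduced.1 hu).2
    omega
  have hnot : ¬ Irreducible q := fun h => hq ⟨h, hdeg⟩
  rw [irreducible_iff] at hnot
  push Not at hnot
  obtain ⟨f, g, rfl, hf, hg⟩ := hnot hnotunit
  have hf0 : f ≠ 0 := left_ne_zero_of_mul hq0
  have hg0 : g ≠ 0 := right_ne_zero_of_mul hq0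
  rw [totalDegree_mul_of_isDomain hf0 hg0] at hdeg
  have hfd : f.totalDegree ≠ 0 := fun h => hf (unit_of_degree f hf0 h)
  have hgd : g.totalDegree ≠ 0 := fun h => hg (unit_of_degree g hg0 h)
  have hF := hline' f hf0 (by omega)
  have hG := hline' g hg0 (by omega)
  have : (Y.filter fun P => eval P (f * g) = 0) ⊆
      (Y.filter fun P => eval P f = 0) ∪ (Y.filter fun P => eval P g = 0) := by
    intro P hP
    simpa [and_or_left] using hP
  have := (Finset.card_le_card this).trans (Finset.card_union_le _ _)
  omega

/-- The rank inequality needed to distribute `T` among `k` conics and `l` lines avoiding `A`. -/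
theorem card_le_rank_of_line_bound {A : Pt} {Y T : Finset Pt} {k l n : ℕ} (hn : 1 ≤ n)
    (hkl : n = 2 * k + l) (hl : l ≤ 1) (hAY : A ∉ Y) (hY : Y.card ≤ 5 * k + 2 * l)
    (hline : ∀ f : Fin 3 → ℝ, f ≠ 0 → (Y.filter fun P => f ⬝ᵥ linearMonomials P = 0).card ≤ n)
    (hconic : ∀ q : BivPoly, Irreducible q → q.totalDegree = 2 → eval A q = 0 →
      (Y.filter fun P => eval P q = 0).card ≤ 2 * n) (hT : T ⊆ Y) :
    T.card ≤ k * (pointRank quadraticMonomials (insert A T) - 1) +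
      l * (pointRank linearMonomials (insert A T) - 1) := by
  have hZ : (insert A T).card = T.card + 1 := Finset.card_insert_of_notMem fun h => hAY (hT h)
  have hTY := Finset.card_le_card hT
  have combine : ∀ a b, a + 1 ≤ pointRank quadraticMonomials (insert A T) →
      b + 1 ≤ pointRank linearMonomials (insert A T) → T.card ≤ k * a + l * b →
      T.card ≤ k * (pointRank quadraticMonomials (insert A T) - 1) +
        l * (pointRank linearMonomials (insert A T) - 1) := fun a b ha hb h =>
    h.trans (add_le_add (Nat.mul_le_mul_left _ (by omega)) (Nat.mul_le_mul_left _ (by omega)))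
  obtain h0 | h1 | h2 : T.card = 0 ∨ T.card = 1 ∨ 2 ≤ T.card := by omega
  · omega
  · exact combine 1 1 (two_le_pointRank_quadratic (by omega)) (two_le_pointRank_linear (by omega))
      (by omega)
  have hq3 := three_le_pointRank_quadratic (Z := insert A T) (by omega)
  by_cases hr1 : pointRank linearMonomials (insert A T) < 3
  · obtain ⟨f, hf, hfZ⟩ := exists_dotProduct_eq_zero_of_pointRank_lt hr1
    have hsub : T ⊆ Y.filter fun P => f ⬝ᵥ linearMonomials P = 0 := fun P hP =>
      Finset.mem_filter.2 ⟨hT hP, hfZ P (Finset.mem_insert_of_mem hP)⟩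
    have := (Finset.card_le_card hsub).trans (hline f hf)
    exact combine 2 1 hq3 (two_le_pointRank_linear (by omega)) (by omega)
  rw [not_lt] at hr1
  by_cases hr6 : 6 ≤ pointRank quadraticMonomials (insert A T)
  · exact combine 5 2 hr6 hr1 (by omega)
  have h4 : T.card ≤ 2 * n := by
    obtain ⟨c, hc, hcZ⟩ := exists_dotProduct_eq_zero_of_pointRank_lt (not_le.1 hr6)
    have hsub : T ⊆ Y.filter fun P => eval P (quadraticPoly c) = 0 := fun P hP =>
      Finset.mem_filter.2 ⟨hT hP, by
        rw [eval_quadraticPoly, hcZ P (Finset.mem_insert_of_mem hP)]⟩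
    refine (Finset.card_le_card hsub).trans ?_
    by_cases hirr : Irreducible (quadraticPoly c) ∧ (quadraticPoly c).totalDegree = 2
    · exact hconic _ hirr.1 hirr.2 (by rw [eval_quadraticPoly, hcZ A (Finset.mem_insert_self _ _)])
    · exact card_filter_conic_le hline (quadraticPoly_ne_zero hc)
        (totalDegree_quadraticPoly_le c) hirr
  by_cases hr5 : 5 ≤ pointRank quadraticMonomials (insert A T)
  · exact combine 4 2 hr5 hr1 (by omega)
  by_cases hthree : ∃ f : Fin 3 → ℝ, f ≠ 0 ∧
      3 ≤ ((insert A T).filter fun P => f ⬝ᵥ linearMonomials P = 0).card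
  · obtain ⟨f, hf, hon⟩ := hthree
    have hsplit : ((insert A T).filter fun P => f ⬝ᵥ linearMonomials P = 0).card +
        ((insert A T).filter fun P => f ⬝ᵥ linearMonomials P ≠ 0).card = (insert A T).card := by
      convert Finset.card_filter_add_card_filter_not (s := insert A T)
        (fun P => f ⬝ᵥ linearMonomials P = 0)
    have hoff2 : ((insert A T).filter fun P => f ⬝ᵥ linearMonomials P ≠ 0).card ≤ 1 := by
      by_contra! hlt
      exact hr5 (add_le_pointRank_of_line le_rfl hon hlt)
    have honle : ((insert A T).filter fun P => f ⬝ᵥ linearMonomials P = 0).card ≤ n + 1 := by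
      have hsub : ((insert A T).filter fun P => f ⬝ᵥ linearMonomials P = 0) ⊆
          insert A (Y.filter fun P => f ⬝ᵥ linearMonomials P = 0) := by
        intro P hP
        simp only [Finset.mem_filter, Finset.mem_insert] at hP ⊢
        exact hP.1.imp_right fun h => ⟨hT h, hP.2⟩
      have := hline f hf
      exact (Finset.card_le_card hsub).trans ((Finset.card_insert_le _ _).trans (by omega))
    by_cases hoff1 : 1 ≤ ((insert A T).filter fun P => f ⬝ᵥ linearMonomials P ≠ 0).card
    · have := add_le_pointRank_of_line one_le_two hon hoff1
      exact combine 3 2 this hr1 (by omega)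
    · exact combine 2 2 hq3 hr1 (by omega)
  · push Not at hthree
    have hgen : ∀ f : Fin 3 → ℝ, f ≠ 0 →
        ((insert A T).filter fun P => f ⬝ᵥ linearMonomials P = 0).card ≤ 2 :=
      fun f hf => Nat.lt_succ_iff.1 (hthree f hf)
    by_cases h3 : 3 ≤ T.card
    · have := min_card_le_pointRank_of_no_three_collinear (Z := insert A T) (by omega) hgen
      exact combine 3 2 (by omega) hr1 (by omega)
    · exact combine 2 2 hq3 hr1 (by omega)

/-- If conditions (a), (b), (c) hold for a node `A` of a set of at most
`2n + ⌊n/2⌋ + 1` nodes, then `A` has an `n`-fundamental polynomial which is a product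
of polynomials of degree 1 or 2. -/
theorem fundamental_product_of_lines_and_conics_of_conds (n : ℕ) (hn : 1 ≤ n)
    (X : Finset Pt) (hcard : X.card ≤ 2 * n + n / 2 + 1) (A : Pt) (hA : A ∈ X)
    (ha : CondA n X A) (hb : CondB n X A) (hc : CondC n X A) :
    ∃ p : BivPoly, IsFundamental n X A p ∧ IsProductOfLinesAndConics p := by
  have key : Covered A n (X.erase A) := by
    have hY : (X.erase A).card ≤ 2 * n + n / 2 := by
      have := Finset.card_erase_add_one hA
      omega
    have hAY : A ∉ X.erase A := Finset.notMem_erase A X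
    generalize hYX : X.erase A = Y at hY hAY
    unfold CondA at ha
    unfold CondB at hb
    unfold CondC at hc
    rw [hYX] at ha hb hc
    by_cases hline : ∃ f : Fin 3 → ℝ, f ≠ 0 ∧
        n + 1 ≤ (Y.filter fun P => f ⬝ᵥ linearMonomials P = 0).card
    · obtain ⟨f, hf, hcardf⟩ := hline
      have hfA : f ⬝ᵥ linearMonomials A ≠ 0 := fun h =>
        ha ⟨_, Finset.filter_subset _ _, hcardf,
          collinear_insert_of_line hf h fun B hB => (Finset.mem_filter.1 hB).2⟩
      obtain ⟨P, hP⟩ := Finset.card_pos.1 (lt_of_lt_of_le n.succ_pos hcardf)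
      obtain ⟨α, hα, hmem⟩ := exists_affineSubspace_of_line hf (Finset.mem_filter.1 hP).2
      have hbα := hb α hα ⟨_, Finset.filter_subset _ _, hcardf,
        fun B hB => (hmem B).2 (Finset.mem_filter.1 hB).2⟩
      have hsplit := Finset.card_filter_add_card_filter_not (s := Y)
        (fun P => f ⬝ᵥ linearMonomials P = 0)
      have hrest : Covered A (2 * 0 + (n - 1))
          (Y.filter fun P => ¬ f ⬝ᵥ linearMonomials P = 0) := by
        refine covered_of_card_le_rank fun T hT => ?_
        have hTcard := Finset.card_le_card hT
        have hTY : T ⊆ Y := hT.trans (Finset.filter_subset _ _)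
        rw [Nat.zero_mul, Nat.zero_add]
        by_cases hT0 : T.card = 0
        · omega
        have hZ : (insert A T).card = T.card + 1 :=
          Finset.card_insert_of_notMem fun h => hAY (hTY h)
        have hr2 := two_le_pointRank_linear (Z := insert A T) (by omega)
        by_cases hr : pointRank linearMonomials (insert A T) < 3
        · obtain ⟨g, hg, hgZ⟩ := exists_dotProduct_eq_zero_of_pointRank_lt hr
          have hTn : T.card ≤ n - 1 := by
            by_contra! hlt
            exact hbα ⟨T, hTY, by omega,
              fun B hB hBα => (Finset.mem_filter.1 (hT hB)).2 ((hmem B).1 hBα),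
              collinear_insert_of_line hg (hgZ A (Finset.mem_insert_self _ _))
                fun B hB => hgZ B (Finset.mem_insert_of_mem hB)⟩
          exact hTn.trans (Nat.le_mul_of_pos_right _ (by omega))
        · calc T.card ≤ (n - 1) * 2 := by omega
            _ ≤ _ := Nat.mul_le_mul_left _ (by omega)
      have hfirst : Covered A 1 (Y.filter fun P => f ⬝ᵥ linearMonomials P = 0) :=
        covered_of_poly one_le_two (linearPoly f) (totalDegree_linearPoly_le f)
          (by rwa [eval_linearPoly])
          (fun B hB => by rw [eval_linearPoly, (Finset.mem_filter.1 hB).2])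
      refine (hfirst.union hrest).mono (by omega) ?_
      rw [Finset.filter_union_filter_not_eq]
    · push Not at hline
      refine (covered_of_card_le_rank (k := n / 2) (l := n % 2) fun T hT =>
        card_le_rank_of_line_bound hn (by omega) (by omega) hAY (by omega)
          (fun f hf => Nat.lt_succ_iff.1 (hline f hf)) (fun q hq hq2 hqA => ?_) hT).mono
        (by omega) subset_rfl
      by_contra! hlt
      exact hc ⟨q, hq, hq2, hqA, hlt⟩
  obtain ⟨p, h1, h2, h3, h4⟩ := key
  exact ⟨p, ⟨h1, h2, fun B hB hBA => h3 B (Finset.mem_erase.2 ⟨hBA, hB⟩)⟩, h4⟩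
end
end

section
/- Let n ≥ 1, let X be a finite set of nodes in ℝ², and let A ∈ X. If there exists an irreducible bivariate real polynomial q of total degree 2 such that q(A) = 0 and q vanishes at at least 2n+1 nodes of X \ {A}, then A has no n-fundamental polynomial with respect to X. -/
open MvPolynomial
open scoped Classical

noncomputable section

namespace BivPoly

/-- The polynomial `x ↦ p (x + A)`. -/
def translate (A : Pt) (p : BivPoly) : BivPoly :=
  aeval (fun i => (X i + C (A i) : BivPoly)) p

theorem eval_translate (A B : Pt) (p : BivPoly) :
    eval B (translate A p) = eval (B + A) p := by
  induction p using MvPolynomial.induction_on with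
  | C r => simp [translate]
  | add p q hp hq => simp only [translate, map_add] at *; rw [hp, hq]
  | mul_X p i hp => simp only [translate, map_mul, aeval_X] at *; rw [hp]; simp

theorem translate_neg_translate (A : Pt) (p : BivPoly) :
    translate (-A) (translate A p) = p := by
  refine MvPolynomial.funext fun x => ?_
  rw [eval_translate, eval_translate, neg_add_cancel_right]

theorem totalDegree_translate_le (A : Pt) (p : BivPoly) :
    (translate A p).totalDegree ≤ p.totalDegree := by
  rw [translate, aeval_eq_eval₂Hom, coe_eval₂Hom, eval₂_eq']
  refine totalDegree_finsetSum_le fun d hd => ?_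
  refine (totalDegree_mul _ _).trans ?_
  have h : ∀ i, ((X i + C (A i) : BivPoly) ^ d i).totalDegree ≤ d i := fun i => by
    refine (totalDegree_pow _ _).trans ?_
    refine (Nat.mul_le_mul_left _ (totalDegree_add _ _)).trans ?_
    simp
  have hd' := le_totalDegree hd
  rw [Finsupp.sum_fintype _ _ (fun _ => rfl), Fin.sum_univ_two] at hd'
  rw [Fin.prod_univ_two, MvPolynomial.algebraMap_eq, totalDegree_C, zero_add]
  exact ((totalDegree_mul _ _).trans (add_le_add (h 0) (h 1))).trans hd'

/-- The general bivariate polynomial of total degree at most `2`. -/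
def conic (r a b c d e : ℝ) : BivPoly :=
  C r + C a * X 0 + C b * X 1 + C c * X 0 ^ 2 + C d * (X 0 * X 1) + C e * X 1 ^ 2

theorem eval_conic (r a b c d e : ℝ) (B : Pt) :
    eval B (conic r a b c d e) =
      r + a * B 0 + b * B 1 + c * B 0 ^ 2 + d * (B 0 * B 1) + e * B 1 ^ 2 := by
  simp [conic]

theorem exists_eq_conic (q : BivPoly) (hq : q.totalDegree ≤ 2) :
    ∃ r a b c d e : ℝ, q = conic r a b c d e := by
  rw [q.as_sum]
  refine Finset.sum_induction _ (fun q => ∃ r a b c d e : ℝ, q = conic r a b c d e) ?_ ?_ ?_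
  · rintro _ _ ⟨r, a, b, c, d, e, rfl⟩ ⟨r', a', b', c', d', e', rfl⟩
    refine ⟨r + r', a + a', b + b', c + c', d + d', e + e', ?_⟩
    simp only [conic, C_add]
    ring
  · exact ⟨0, 0, 0, 0, 0, 0, by simp [conic]⟩
  · intro m hm
    have hm' := (le_totalDegree hm).trans hq
    rw [Finsupp.sum_fintype _ _ (fun _ => rfl), Fin.sum_univ_two] at hm'
    rw [monomial_eq, Finsupp.prod_fintype _ _ (fun _ => pow_zero _), Fin.prod_univ_two]
    generalize coeff m q = t
    generalize m 0 = i at *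
    generalize m 1 = j at *
    have h : i = 0 ∧ j = 0 ∨ i = 1 ∧ j = 0 ∨ i = 0 ∧ j = 1 ∨ i = 2 ∧ j = 0 ∨ i = 1 ∧ j = 1 ∨
        i = 0 ∧ j = 2 := by lia
    rcases h with ⟨rfl, rfl⟩ | ⟨rfl, rfl⟩ | ⟨rfl, rfl⟩ | ⟨rfl, rfl⟩ | ⟨rfl, rfl⟩ | ⟨rfl, rfl⟩
    · exact ⟨t, 0, 0, 0, 0, 0, by simp [conic]⟩
    · exact ⟨0, t, 0, 0, 0, 0, by simp [conic]⟩
    · exact ⟨0, 0, t, 0, 0, 0, by simp [conic]⟩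
    · exact ⟨0, 0, 0, t, 0, 0, by simp [conic]⟩
    · exact ⟨0, 0, 0, 0, t, 0, by simp [conic]⟩
    · exact ⟨0, 0, 0, 0, 0, t, by simp [conic]⟩

theorem totalDegree_affine_le (r a b : ℝ) :
    (C r + C a * X 0 + C b * X 1 : BivPoly).totalDegree ≤ 1 := by
  refine (totalDegree_add _ _).trans (max_le ((totalDegree_add _ _).trans (max_le ?_ ?_)) ?_)
  · simp
  all_goals exact (totalDegree_mul _ _).trans (by simp)

theorem ne_mul_of_irreducible {q f g : BivPoly} (hq : Irreducible q) (hdeg : q.totalDegree = 2)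
    (hf : f.totalDegree ≤ 1) (hg : g.totalDegree ≤ 1) : q ≠ f * g := by
  intro h
  have hle : q.totalDegree ≤ f.totalDegree + g.totalDegree := h ▸ totalDegree_mul f g
  rcases hq.isUnit_or_isUnit h with hu | hu <;>
  · have := (isUnit_iff_totalDegree_of_isReduced.mp hu).2
    lia

/-- A conic containing a line through the origin splits into two affine factors. -/
theorem exists_conic_eq_mul {a b c d e v w : ℝ} (hv : v ≠ 0 ∨ w ≠ 0)
    (hl : a * v + b * w = 0) (hQ : c * v ^ 2 + d * (v * w) + e * w ^ 2 = 0) :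
    ∃ f g : BivPoly, f.totalDegree ≤ 1 ∧ g.totalDegree ≤ 1 ∧ conic 0 a b c d e = f * g := by
  suffices h : ∃ r s t : ℝ, a = w * r ∧ b = -v * r ∧ c = w * s ∧ d = w * t - v * s ∧
      e = -v * t by
    obtain ⟨r, s, t, rfl, rfl, rfl, rfl, rfl⟩ := h
    refine ⟨C 0 + C w * X 0 + C (-v) * X 1, C r + C s * X 0 + C t * X 1,
      totalDegree_affine_le _ _ _, totalDegree_affine_le _ _ _, ?_⟩
    simp only [conic, C_mul, C_sub, C_neg, C_0]
    ring
  by_cases hw : w = 0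
  · subst hw
    have hv : v ≠ 0 := by simpa using hv
    have ha : a = 0 := by simpa [hv] using hl
    have hc : c = 0 := by simpa [hv] using hQ
    exact ⟨-b / v, -d / v, -e / v, by simp [ha], by field_simp, by simp [hc], by field_simp; ring,
      by field_simp⟩
  · refine ⟨a / w, c / w, (d + v * (c / w)) / w, by field_simp, ?_, by field_simp,
      by field_simp; ring, ?_⟩
    · field_simp; linarith
    · field_simp; linarith

/-- Projecting from the origin parametrizes the conic
`a x + b y + c x² + d x y + e y² = 0` by rational functions of degree two, so a polynomial of
degree at most `n` with `2n + 1` zeros on the conic outside its tangent at the origin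
also vanishes at the origin. -/
theorem eval_zero_eq_zero_of_conic {n : ℕ} {a b c d e : ℝ} (hab : a ^ 2 + b ^ 2 ≠ 0)
    (hQ : c * b ^ 2 - d * (a * b) + e * a ^ 2 ≠ 0) {p : BivPoly} (hp : p.totalDegree ≤ n)
    {S : Finset Pt} (hS : 2 * n + 1 ≤ S.card)
    (hS0 : ∀ B ∈ S, a * B 0 + b * B 1 ≠ 0)
    (hSq : ∀ B ∈ S, eval B (conic 0 a b c d e) = 0) (hSp : ∀ B ∈ S, eval B p = 0) :
    eval 0 p = 0 := by
  set k : ℝ := a ^ 2 + b ^ 2 with hk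
  let x : Polynomial ℝ := Polynomial.C (-b) * Polynomial.X + Polynomial.C a
  let y : Polynomial ℝ := Polynomial.C a * Polynomial.X + Polynomial.C b
  let R : Polynomial ℝ := Polynomial.C (c * b ^ 2 - d * (a * b) + e * a ^ 2) * Polynomial.X ^ 2 +
    Polynomial.C (-2 * a * b * c + d * (a ^ 2 - b ^ 2) + 2 * a * b * e) * Polynomial.X +
    Polynomial.C (c * a ^ 2 + d * (a * b) + e * b ^ 2)
  have hx : x.natDegree ≤ 1 := Polynomial.natDegree_linear_le
  have hy : y.natDegree ≤ 1 := Polynomial.natDegree_linear_le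
  have hR : R.natDegree ≤ 2 := Polynomial.natDegree_quadratic_le
  have hxe : ∀ s, x.eval s = -b * s + a := fun s => by simp [x]
  have hye : ∀ s, y.eval s = a * s + b := fun s => by simp [y]
  have hRe : ∀ s, R.eval s =
      c * x.eval s ^ 2 + d * (x.eval s * y.eval s) + e * y.eval s ^ 2 := fun s => by
    simp [x, y, R]; ring
  let T : (Fin 2 →₀ ℕ) → Polynomial ℝ := fun m =>
    Polynomial.C (coeff m p * (-k) ^ (m 0 + m 1)) * (x ^ m 0 * y ^ m 1 * R ^ (n - (m 0 + m 1)))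
  let F : Polynomial ℝ := ∑ m ∈ p.support, T m
  have hm : ∀ m ∈ p.support, m 0 + m 1 ≤ n := fun m h => by
    have := (le_totalDegree h).trans hp
    rwa [Finsupp.sum_fintype _ _ (fun _ => rfl), Fin.sum_univ_two] at this
  have hTdeg : ∀ m ∈ p.support, (T m).natDegree ≤ 2 * n - (m 0 + m 1) := fun m h => by
    refine (Polynomial.natDegree_C_mul_le _ _).trans ?_
    have h1 := Polynomial.natDegree_pow_le_of_le (m 0) hx
    have h2 := Polynomial.natDegree_pow_le_of_le (m 1) hy
    have h3 := Polynomial.natDegree_pow_le_of_le (n - (m 0 + m 1)) hR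
    have h4 := Polynomial.natDegree_mul_le_of_le (Polynomial.natDegree_mul_le_of_le h1 h2) h3
    have := hm m h
    lia
  have hFdeg : F.natDegree ≤ 2 * n :=
    Polynomial.natDegree_sum_le_of_forall_le _ _ fun m h => (hTdeg m h).trans (Nat.sub_le _ _)
  -- The leading coefficient of `F` only sees the constant term of `p`.
  have hFcoeff : F.coeff (2 * n) =
      coeff 0 p * (c * b ^ 2 - d * (a * b) + e * a ^ 2) ^ n := by
    have hR2 : R.coeff 2 = c * b ^ 2 - d * (a * b) + e * a ^ 2 := by
      simp only [R, Polynomial.coeff_add, Polynomial.coeff_C_mul, Polynomial.coeff_X_pow,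
        Polynomial.coeff_X, Polynomial.coeff_C]
      norm_num
    rw [Polynomial.finsetSum_coeff, Finset.sum_eq_single (0 : Fin 2 →₀ ℕ)]
    · simp only [T, Finsupp.coe_zero, Pi.zero_apply, add_zero, pow_zero, mul_one, one_mul,
        Nat.sub_zero, Polynomial.coeff_C_mul]
      rw [mul_comm 2 n, Polynomial.coeff_pow_of_natDegree_le hR, hR2]
    · intro m h h0
      refine Polynomial.coeff_eq_zero_of_natDegree_lt ((hTdeg m h).trans_lt ?_)
      have : m 0 + m 1 ≠ 0 := fun h' => h0 (by
        ext i; fin_cases i <;> simp <;> lia)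
      have := hm m h
      lia
    · intro h
      simp [T, notMem_support_iff.mp h]
  have hparam : ∀ B ∈ S, ∃ u : ℝ,
      B 0 = u * x.eval ((a * B 1 - b * B 0) / (a * B 0 + b * B 1)) ∧
      B 1 = u * y.eval ((a * B 1 - b * B 0) / (a * B 0 + b * B 1)) ∧
      -k = u * R.eval ((a * B 1 - b * B 0) / (a * B 0 + b * B 1)) := by
    intro B hB
    have h0 := hS0 B hB
    have hq := hSq B hB
    rw [eval_conic] at hq
    set l := a * B 0 + b * B 1 with hl
    have hB0 : B 0 = l / k * x.eval ((a * B 1 - b * B 0) / l) := by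
      rw [hxe]; field_simp; rw [hk, hl]; ring
    have hB1 : B 1 = l / k * y.eval ((a * B 1 - b * B 0) / l) := by
      rw [hye]; field_simp; rw [hk, hl]; ring
    refine ⟨l / k, hB0, hB1, ?_⟩
    rw [hRe]
    generalize Polynomial.eval ((a * B 1 - b * B 0) / l) x = z at *
    generalize Polynomial.eval ((a * B 1 - b * B 0) / l) y = z' at *
    have hlk : l / k ≠ 0 := div_ne_zero h0 hab
    have hlk' : l = l / k * k := by field_simp
    generalize l / k = u at *
    refine mul_left_cancel₀ hlk ?_
    have : l + c * B 0 ^ 2 + d * (B 0 * B 1) + e * B 1 ^ 2 = 0 := by linarith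
    rw [hB0, hB1, hlk'] at this
    linarith
  have hF : F = 0 := by
    refine Polynomial.eq_zero_of_natDegree_lt_card_of_eval_eq_zero' F
      (S.image fun B => (a * B 1 - b * B 0) / (a * B 0 + b * B 1)) ?_ ?_
    · intro s hs
      obtain ⟨B, hB, rfl⟩ := Finset.mem_image.mp hs
      obtain ⟨u, h0, h1, h2⟩ := hparam B hB
      have hpB := hSp B hB
      rw [eval_eq'] at hpB
      generalize (a * B 1 - b * B 0) / (a * B 0 + b * B 1) = s at *
      have : F.eval s = R.eval s ^ n * ∑ m ∈ p.support, coeff m p * ∏ i, B i ^ m i := by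
        rw [Polynomial.eval_finsetSum, Finset.mul_sum]
        refine Finset.sum_congr rfl fun m h => ?_
        obtain ⟨j, hj⟩ := Nat.exists_eq_add_of_le (hm m h)
        simp only [T, Polynomial.eval_mul, Polynomial.eval_C, Polynomial.eval_pow,
          Fin.prod_univ_two]
        rw [h0, h1, h2, hj, Nat.add_sub_cancel_left]
        ring
      rw [this, hpB, mul_zero]
    · rw [Finset.card_image_of_injOn]
      · lia
      · intro B hB B' hB' h
        obtain ⟨u, h0, h1, h2⟩ := hparam B hB
        obtain ⟨u', h0', h1', h2'⟩ := hparam B' hB'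
        simp only at h
        rw [← h] at h0' h1' h2'
        have hu : u = u' := by
          refine mul_right_cancel₀ (fun h3 => hab ?_) (h2.symm.trans h2')
          rw [h3, mul_zero] at h2
          exact neg_eq_zero.mp h2
        ext i
        fin_cases i
        · exact h0.trans (hu ▸ h0'.symm)
        · exact h1.trans (hu ▸ h1'.symm)
  rw [hF, Polynomial.coeff_zero] at hFcoeff
  rw [eval_zero, constantCoeff_eq]
  exact (mul_eq_zero.mp hFcoeff.symm).resolve_right (pow_ne_zero _ hQ)

end BivPoly

/-- If an irreducible polynomial `q` of total degree `2` vanishes at `A` and at at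
least `2n+1` nodes of `X \ {A}`, then `A` has no `n`-fundamental polynomial. -/
theorem no_fundamental_of_conic (n : ℕ) (hn : 1 ≤ n) (X : Finset Pt) (A : Pt)
    (hA : A ∈ X) (q : BivPoly) (hq : Irreducible q) (hdeg : q.totalDegree = 2)
    (hqA : eval A q = 0)
    (hcount : 2 * n + 1 ≤ ((X.erase A).filter (fun B => eval B q = 0)).card) :
    ¬ ∃ p : BivPoly, IsFundamental n X A p := by
  rintro ⟨p, hp, hpA, hpX⟩
  obtain ⟨r, a, b, c, d, e, hconic⟩ := BivPoly.exists_eq_conic (BivPoly.translate A q)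
    ((BivPoly.totalDegree_translate_le A q).trans hdeg.le)
  have hr : r = 0 := by
    have := BivPoly.eval_translate A 0 q
    rw [hconic, BivPoly.eval_conic, zero_add, hqA] at this
    simpa using this
  subst hr
  have hline : ∀ v w : ℝ, v ≠ 0 ∨ w ≠ 0 → a * v + b * w = 0 →
      c * v ^ 2 + d * (v * w) + e * w ^ 2 ≠ 0 := by
    intro v w hvw hl hQ
    obtain ⟨f, g, hf, hg, hfg⟩ := BivPoly.exists_conic_eq_mul hvw hl hQ
    refine BivPoly.ne_mul_of_irreducible hq hdeg
      ((BivPoly.totalDegree_translate_le (-A) f).trans hf)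
      ((BivPoly.totalDegree_translate_le (-A) g).trans hg) ?_
    rw [← BivPoly.translate_neg_translate A q, hconic, hfg]
    simp [BivPoly.translate]
  let S : Finset Pt := ((X.erase A).filter (fun B => eval B q = 0)).image (fun B => B - A)
  have hS : ∀ B ∈ S, B ≠ 0 ∧ eval B (BivPoly.conic 0 a b c d e) = 0 ∧
      eval B (BivPoly.translate A p) = 0 := by
    intro B hB
    obtain ⟨B, hBf, rfl⟩ := Finset.mem_image.mp hB
    obtain ⟨hBX, hBq⟩ := Finset.mem_filter.mp hBf
    obtain ⟨hBA, hBX⟩ := Finset.mem_erase.mp hBX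
    refine ⟨sub_ne_zero.mpr hBA, ?_, ?_⟩
    · rw [← hconic, BivPoly.eval_translate, sub_add_cancel, hBq]
    · rw [BivPoly.eval_translate, sub_add_cancel, hpX B hBX hBA]
  have hcard : 2 * n + 1 ≤ S.card := by
    rwa [Finset.card_image_of_injective _ (sub_left_injective (b := A))]
  have hS0 : ∀ B ∈ S, a * B 0 + b * B 1 ≠ 0 := by
    intro B hB hl
    obtain ⟨hB0, hBq, -⟩ := hS B hB
    rw [BivPoly.eval_conic] at hBq
    refine hline (B 0) (B 1) ?_ hl (by linarith)
    by_contra! h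
    exact hB0 (by ext i; fin_cases i <;> simp [h])
  have hab : a ≠ 0 ∨ b ≠ 0 := by
    obtain ⟨B, hB⟩ := Finset.card_pos.mp (by lia : 0 < S.card)
    by_contra! h
    exact hS0 B hB (by simp [h])
  have hab' : a ^ 2 + b ^ 2 ≠ 0 := by
    rcases hab with h | h <;> positivity
  have hQ := hline (-b) a (hab.symm.imp_left neg_ne_zero.mpr) (by ring)
  have h := BivPoly.eval_zero_eq_zero_of_conic hab' (fun h => hQ (by linarith))
    ((BivPoly.totalDegree_translate_le A p).trans hp) hcard hS0
    (fun B hB => (hS B hB).2.1) (fun B hB => (hS B hB).2.2)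
  rw [BivPoly.eval_translate, zero_add, hpA] at h
  exact one_ne_zero h
end
end

section
/- Let n ≥ 1, let X be a finite set of nodes in ℝ² with #X ≤ 2n + ⌊n/2⌋ + 1, and let A ∈ X. If A has an n-fundamental polynomial with respect to X, then: (a) no affine line contains A together with n+1 nodes of X \ {A}; and (b) if n+1 nodes of X \ {A} lie on an affine line α, then no affine line contains A together with n nodes of X \ ({A} ∪ α). -/
open MvPolynomial
open scoped Classical

noncomputable section

/-- The restriction of `p` to the parametrized line `t ↦ P + t • v`. -/
def lineRestrict (P v : Pt) (p : BivPoly) : Polynomial ℝ :=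
  aeval (fun i => Polynomial.C (v i) * Polynomial.X + Polynomial.C (P i)) p

theorem eval_lineRestrict (P v : Pt) (p : BivPoly) (t : ℝ) :
    (lineRestrict P v p).eval t = eval (t • v + P) p := by
  have h : (Polynomial.evalRingHom t).comp
      ((aeval (fun i => Polynomial.C (v i) * Polynomial.X + Polynomial.C (P i)) :
        BivPoly →ₐ[ℝ] Polynomial ℝ) : BivPoly →+* Polynomial ℝ) = eval (t • v + P) := by
    apply MvPolynomial.ringHom_ext
    · intro r
      simp
    · intro i
      simp [mul_comm t]
  exact congrArg (fun f : BivPoly →+* ℝ => f p) h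

theorem natDegree_lineRestrict_le (P v : Pt) (p : BivPoly) :
    (lineRestrict P v p).natDegree ≤ p.totalDegree := by
  simpa [lineRestrict] using MvPolynomial.aeval_natDegree_le (n := 1) p le_rfl
    (fun i => Polynomial.C (v i) * Polynomial.X + Polynomial.C (P i))
    (fun i => Polynomial.natDegree_linear_le)

/-- The coefficient of degree `n ≥ deg p` of a restriction to a line depends on the direction of
the line only. -/
theorem coeff_lineRestrict {n : ℕ} {p : BivPoly} (hp : p.totalDegree ≤ n) (P v : Pt) :
    (lineRestrict P v p).coeff n = eval v (homogeneousComponent n p) := by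
  rw [lineRestrict, aeval_def, eval₂_eq', Polynomial.finsetSum_coeff,
    homogeneousComponent_apply, map_sum, Finset.sum_filter]
  refine Finset.sum_congr rfl fun d hd => ?_
  have hlin : ∀ i, (Polynomial.C (v i) * Polynomial.X + Polynomial.C (P i)).natDegree ≤ 1 :=
    fun i => Polynomial.natDegree_linear_le
  have hpow : ∀ i, ((Polynomial.C (v i) * Polynomial.X + Polynomial.C (P i)) ^ d i).natDegree
      ≤ d i := fun i => by
    simpa using Polynomial.natDegree_pow_le_of_le (d i) (hlin i)
  have hcoeff : ∀ i, ((Polynomial.C (v i) * Polynomial.X + Polynomial.C (P i)) ^ d i).coeff (d i)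
      = v i ^ d i := fun i => by
    simpa using Polynomial.coeff_pow_of_natDegree_le (m := d i) (hlin i)
  have hdn : d.degree ≤ n := (le_totalDegree hd).trans hp
  rw [Finsupp.degree_eq_sum, Fin.sum_univ_two] at hdn ⊢
  rw [Fin.prod_univ_two, Polynomial.algebraMap_eq, Polynomial.coeff_C_mul]
  split_ifs with h
  · rw [← h, Polynomial.coeff_mul_add_eq_of_natDegree_le (hpow 0) (hpow 1), hcoeff, hcoeff,
      eval_monomial, Finsupp.prod_fintype _ _ fun i => pow_zero _, Fin.prod_univ_two]
  · have hlt := Polynomial.natDegree_mul_le_of_le (hpow 0) (hpow 1)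
    rw [Polynomial.coeff_eq_zero_of_natDegree_lt (by omega), mul_zero]

theorem lineRestrict_eq_zero {n : ℕ} {p : BivPoly} {P v : Pt}
    (hdeg : (lineRestrict P v p).natDegree ≤ n) (S : Finset Pt) (hS : n + 1 ≤ S.card)
    (hline : ∀ B ∈ S, ∃ t : ℝ, B = t • v + P) (hzero : ∀ B ∈ S, eval B p = 0) :
    lineRestrict P v p = 0 := by
  choose! t ht using hline
  have hinj : Set.InjOn t S := fun B hB B' hB' h => by rw [ht B hB, ht B' hB', h]
  refine Polynomial.eq_zero_of_natDegree_lt_card_of_eval_eq_zero' _ (S.image t) ?_ ?_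
  · intro r hr
    obtain ⟨B, hB, rfl⟩ := Finset.mem_image.1 hr
    rw [eval_lineRestrict, ← ht B hB, hzero B hB]
  · rw [Finset.card_image_of_injOn hinj]
    omega

/-- A polynomial of degree at most `n` vanishing at `n + 1` points of a line vanishes on it. -/
theorem eval_eq_zero_of_line {n : ℕ} {p : BivPoly} {P v : Pt} (hp : p.totalDegree ≤ n)
    (S : Finset Pt) (hS : n + 1 ≤ S.card) (hline : ∀ B ∈ S, ∃ t : ℝ, B = t • v + P)
    (hzero : ∀ B ∈ S, eval B p = 0) (t : ℝ) : eval (t • v + P) p = 0 := by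
  rw [← eval_lineRestrict,
    lineRestrict_eq_zero ((natDegree_lineRestrict_le P v p).trans hp) S hS hline hzero,
    Polynomial.eval_zero]

theorem exists_direction_of_collinear_insert {A : Pt} {S : Set Pt}
    (h : Collinear ℝ (insert A S)) : ∃ v : Pt, ∀ B ∈ S, ∃ t : ℝ, B = t • v + A := by
  obtain ⟨v, hv⟩ := (collinear_iff_of_mem (Set.mem_insert A S)).1 h
  exact ⟨v, fun B hB => by simpa using hv B (Set.mem_insert_of_mem A hB)⟩

theorem condA_of_isFundamental {n : ℕ} {X : Finset Pt} {A : Pt} {p : BivPoly}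
    (hp : IsFundamental n X A p) : CondA n X A := by
  rintro ⟨S, hSX, hS, hcol⟩
  obtain ⟨v, hv⟩ := exists_direction_of_collinear_insert hcol
  have h := eval_eq_zero_of_line hp.1 S hS hv
    (fun B hB => hp.2.2 B (Finset.mem_of_mem_erase (hSX hB)) (Finset.ne_of_mem_erase (hSX hB))) 0
  rw [zero_smul, zero_add, hp.2.1] at h
  exact one_ne_zero h

/-- Two lines in the plane meet or have proportional directions. -/
theorem lines_meet_or_parallel (A P v w : Pt) (hw : w ≠ 0) :
    (∃ s t : ℝ, s • v + A = t • w + P) ∨ ∃ c : ℝ, v = c • w := by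
  by_cases hD : v 0 * w 1 - v 1 * w 0 = 0
  · right
    by_cases h0 : w 0 = 0
    · have h1 : w 1 ≠ 0 := fun h1 => hw (by ext i; fin_cases i <;> simp [h0, h1])
      refine ⟨v 1 / w 1, ?_⟩
      have hv : v 0 = 0 := by simpa [h0, h1] using hD
      ext i
      fin_cases i <;> simp [h0, h1, hv]
    · refine ⟨v 0 / w 0, ?_⟩
      ext i
      fin_cases i
      · simp [h0]
      · simp only [Fin.mk_one, Pi.smul_apply, smul_eq_mul]
        field_simp
        linarith
  · left
    have he := mul_inv_cancel₀ hD
    refine ⟨((P 0 - A 0) * w 1 - (P 1 - A 1) * w 0) * (v 0 * w 1 - v 1 * w 0)⁻¹,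
      ((P 0 - A 0) * v 1 - (P 1 - A 1) * v 0) * (v 0 * w 1 - v 1 * w 0)⁻¹, ?_⟩
    ext i
    fin_cases i <;>
      simp only [Fin.zero_eta, Fin.mk_one, Pi.add_apply, Pi.smul_apply, smul_eq_mul]
    · linear_combination (P 0 - A 0) * he
    · linear_combination (P 1 - A 1) * he

theorem condB_of_isFundamental {n : ℕ} (hn : 1 ≤ n) {X : Finset Pt} {A : Pt} {p : BivPoly}
    (hp : IsFundamental n X A p) : CondB n X A := by
  rintro α hα ⟨S, hSX, hS, hSα⟩ ⟨T, hTX, hT, hTα, hcol⟩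
  have hzero : ∀ B ∈ X.erase A, eval B p = 0 := fun B hB =>
    hp.2.2 B (Finset.mem_of_mem_erase hB) (Finset.ne_of_mem_erase hB)
  obtain ⟨v, hv⟩ := exists_direction_of_collinear_insert hcol
  obtain ⟨w, hw, hspan⟩ := finrank_eq_one_iff'.1 hα
  obtain ⟨P, hPS⟩ := Finset.card_pos.1 (by omega : 0 < S.card)
  have hP : P ∈ α := hSα hPS
  have hline : ∀ B ∈ S, ∃ t : ℝ, B = t • (w : Pt) + P := fun B hB => by
    obtain ⟨t, ht⟩ := hspan ⟨B -ᵥ P, α.vsub_mem_direction (hSα hB) hP⟩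
    refine ⟨t, ?_⟩
    have ht' : t • (w : Pt) = B - P := congrArg Subtype.val ht
    rw [ht', sub_add_cancel]
  have hmem : ∀ t : ℝ, t • (w : Pt) + P ∈ α := fun t =>
    α.vadd_mem_of_mem_direction (α.direction.smul_mem t w.2) hP
  have hrestr := eval_eq_zero_of_line hp.1 S hS hline fun B hB => hzero B (hSX hB)
  suffices h : lineRestrict A v p = 0 by
    have h' := eval_lineRestrict A v p 0
    rw [h, zero_smul, zero_add, hp.2.1, Polynomial.eval_zero] at h'
    exact zero_ne_one h'
  rcases lines_meet_or_parallel A P v w (by simpa using hw) with ⟨s, t, hst⟩ | ⟨c, hc⟩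
  · refine lineRestrict_eq_zero ((natDegree_lineRestrict_le A v p).trans hp.1)
      (insert (t • (w : Pt) + P) T) ?_ ?_ ?_
    · rw [Finset.card_insert_of_notMem fun h => hTα _ h (hmem t)]
      omega
    · intro B hB
      rcases Finset.mem_insert.1 hB with rfl | hB
      · exact ⟨s, hst.symm⟩
      · exact hv B hB
    · intro B hB
      rcases Finset.mem_insert.1 hB with rfl | hB
      · exact hrestr t
      · exact hzero B (hTX hB)
  · have hPv : lineRestrict P v p = 0 := Polynomial.funext fun t => by
      rw [eval_lineRestrict, hc, smul_smul, hrestr, Polynomial.eval_zero]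
    have hcoeff : (lineRestrict A v p).coeff n = 0 := by
      rw [coeff_lineRestrict hp.1, ← coeff_lineRestrict hp.1 P, hPv, Polynomial.coeff_zero]
    have hdeg : (lineRestrict A v p).natDegree ≤ n - 1 :=
      Polynomial.natDegree_le_pred ((natDegree_lineRestrict_le A v p).trans hp.1) hcoeff
    exact lineRestrict_eq_zero hdeg T (by omega) hv fun B hB => hzero B (hTX hB)

/-- If a node `A` of a set of at most `2n + ⌊n/2⌋ + 1` nodes has an `n`-fundamental
polynomial, then conditions (a) and (b) hold. -/
theorem conds_of_fundamental (n : ℕ) (hn : 1 ≤ n) (X : Finset Pt)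
    (hcard : X.card ≤ 2 * n + n / 2 + 1) (A : Pt) (hA : A ∈ X)
    (hfund : ∃ p : BivPoly, IsFundamental n X A p) :
    CondA n X A ∧ CondB n X A := by
  obtain ⟨p, hp⟩ := hfund
  exact ⟨condA_of_isFundamental hp, condB_of_isFundamental hn hp⟩
end
end
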